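/- arXiv:2006.07222 — 6 statements merged into one kernel-verified Lean document; each statement's English description precedes it below -/
import Mathlib

section
/- Let u : ℝⁿ → ℝ be locally Lipschitz and C-semiconcave on ℝⁿ for some C > 0. Then for all points p, q ∈ ℝⁿ one has u(q) ≤ u(p) + |∇u|(p)·‖q − p‖ + C·‖q − p‖², where |∇u|(p) := max(0, sup_{‖v‖=1} ∂⁺_v u(p)) is the norm of the generalized gradient of u at p. -/
open Filter Metric Set

noncomputable section

/-- Euclidean space `ℝⁿ`. -/
abbrev Euc (n : ℕ) := EuclideanSpace ℝ (Fin n)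

/-- `u` is `C`-semiconcave on a (convex) set `S`: for all `x y ∈ S` and `l ∈ [0,1]`,
`(1-l)·u x + l·u y - u((1-l)x + l y) ≤ C·l·(1-l)·‖x-y‖²`. -/
def SemiconcaveOn {n : ℕ} (C : ℝ) (S : Set (Euc n)) (u : Euc n → ℝ) : Prop :=
  ∀ x ∈ S, ∀ y ∈ S, ∀ l : ℝ, 0 ≤ l → l ≤ 1 →
    (1 - l) * u x + l * u y - u ((1 - l) • x + l • y) ≤ C * l * (1 - l) * ‖x - y‖ ^ 2

/-- The one-sided directional derivative of `u` at `p` in direction `v` exists and equals `d`. -/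
def HasPosDirDeriv {n : ℕ} (u : Euc n → ℝ) (p v : Euc n) (d : ℝ) : Prop :=
  Tendsto (fun t : ℝ => (u (p + t • v) - u p) / t) (nhdsWithin 0 (Ioi 0)) (nhds d)

/-- The one-sided directional derivative `∂⁺_v u(p)` (junk value if the limit does not exist). -/
def posDirDeriv {n : ℕ} (u : Euc n → ℝ) (p v : Euc n) : ℝ :=
  limUnder (nhdsWithin 0 (Ioi 0)) (fun t : ℝ => (u (p + t • v) - u p) / t)

/-- The norm of the generalized gradient: `|∇u|(p) = max(0, sup_{‖v‖=1} ∂⁺_v u(p))`. -/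
def gradNorm {n : ℕ} (u : Euc n → ℝ) (p : Euc n) : ℝ :=
  max 0 (sSup {d : ℝ | ∃ v : Euc n, ‖v‖ = 1 ∧ d = posDirDeriv u p v})

/-- Along a ray of unit speed, the difference quotient of a `C`-semiconcave function becomes
nonincreasing after subtracting `C * t`. -/
lemma SemiconcaveOn.antitoneOn_quotient_sub {n : ℕ} {C : ℝ} {u : Euc n → ℝ}
    (hsc : SemiconcaveOn C Set.univ u) (p : Euc n) {v : Euc n} (hv : ‖v‖ = 1) :
    AntitoneOn (fun t : ℝ => (u (p + t • v) - u p) / t - C * t) (Ioi 0) := by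
  intro t ht s hs hts
  have ht0 : 0 < t := ht
  have hs0 : 0 < s := hs
  have h := hsc p (mem_univ _) (p + s • v) (mem_univ _) (t / s) (by positivity)
    ((div_le_one hs0).2 hts)
  have hpt : (1 - t / s) • p + (t / s) • (p + s • v) = p + t • v := by
    rw [smul_add, smul_smul, div_mul_cancel₀ _ hs0.ne', sub_smul, one_smul]
    abel
  have hnorm : ‖p - (p + s • v)‖ = s := by
    rw [sub_add_cancel_left, norm_neg, norm_smul, hv, mul_one, Real.norm_of_nonneg hs0.le]
  rw [hpt, hnorm] at h
  have key : (u (p + s • v) - u p) / s - C * s + C * t ≤ (u (p + t • v) - u p) / t := by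
    rw [le_div_iff₀ ht0]
    calc ((u (p + s • v) - u p) / s - C * s + C * t) * t
        = (1 - t / s) * u p + t / s * u (p + s • v)
            - C * (t / s) * (1 - t / s) * s ^ 2 - u p := by field_simp; ring
      _ ≤ u (p + t • v) - u p := by linarith
  change (u (p + s • v) - u p) / s - C * s ≤ (u (p + t • v) - u p) / t - C * t
  linarith

/-- The corrected difference quotients at a point of a locally Lipschitz semiconcave function are
bounded above, uniformly over unit directions. -/
lemma SemiconcaveOn.exists_quotient_sub_le {n : ℕ} {C : ℝ} (hC : 0 ≤ C) {u : Euc n → ℝ}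
    (hLip : LocallyLipschitz u) (hsc : SemiconcaveOn C Set.univ u) (p : Euc n) :
    ∃ K : ℝ, ∀ v : Euc n, ‖v‖ = 1 → ∀ t : ℝ, 0 < t →
      (u (p + t • v) - u p) / t - C * t ≤ K := by
  obtain ⟨K, U, hU, hK⟩ := hLip p
  obtain ⟨δ, hδ, hball⟩ := Metric.mem_nhds_iff.1 hU
  refine ⟨K, fun v hv t ht => ?_⟩
  have hτ : 0 < min t (δ / 2) := lt_min ht (by positivity)
  refine (hsc.antitoneOn_quotient_sub p hv hτ ht (min_le_left _ _)).trans ?_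
  set τ := min t (δ / 2)
  have hdist : dist (p + τ • v) p = τ := by
    rw [dist_eq_norm, add_sub_cancel_left, norm_smul, hv, mul_one, Real.norm_of_nonneg hτ.le]
  have hτδ : τ < δ := (min_le_right _ _).trans_lt (by linarith)
  have hmem : p + τ • v ∈ U := hball (by rwa [Metric.mem_ball, hdist])
  have h := hK.dist_le_mul _ hmem p (mem_of_mem_nhds hU)
  rw [hdist, Real.dist_eq] at h
  have hq : (u (p + τ • v) - u p) / τ ≤ K := (div_le_iff₀ hτ).2 ((le_abs_self _).trans h)
  have hCτ : 0 ≤ C * τ := by positivity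
  change (u (p + τ • v) - u p) / τ - C * τ ≤ K
  linarith

lemma SemiconcaveOn.hasPosDirDeriv_sSup {n : ℕ} {C : ℝ} (hC : 0 ≤ C) {u : Euc n → ℝ}
    (hLip : LocallyLipschitz u) (hsc : SemiconcaveOn C Set.univ u) (p : Euc n) {v : Euc n}
    (hv : ‖v‖ = 1) :
    HasPosDirDeriv u p v
      (sSup ((fun t : ℝ => (u (p + t • v) - u p) / t - C * t) '' Ioi 0)) := by
  obtain ⟨K, hK⟩ := hsc.exists_quotient_sub_le hC hLip p
  have h := (hsc.antitoneOn_quotient_sub p hv).tendsto_nhdsGT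
    ⟨K, forall_mem_image.2 fun t ht => hK v hv t ht⟩
  have hlin : Tendsto (fun t : ℝ => C * t) (nhdsWithin 0 (Ioi 0)) (nhds 0) := by
    have : Tendsto (fun t : ℝ => C * t) (nhds 0) (nhds (C * 0)) :=
      (continuous_const_mul C).tendsto 0
    rw [mul_zero] at this
    exact this.mono_left nhdsWithin_le_nhds
  simpa [HasPosDirDeriv] using h.add hlin

theorem stmt3 {n : ℕ} (hn : 0 < n) (C : ℝ) (hC : 0 < C) (u : Euc n → ℝ)
    (hLip : LocallyLipschitz u) (hsc : SemiconcaveOn C Set.univ u) :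
    ∀ p q : Euc n, u q ≤ u p + gradNorm u p * ‖q - p‖ + C * ‖q - p‖ ^ 2 := by
  intro p q
  obtain rfl | hqp := eq_or_ne q p
  · simp
  have hr : 0 < ‖q - p‖ := norm_pos_iff.2 (sub_ne_zero.2 hqp)
  set r := ‖q - p‖ with hr_def
  obtain ⟨K, hK⟩ := hsc.exists_quotient_sub_le hC.le hLip p
  have hderiv : ∀ v : Euc n, ‖v‖ = 1 → posDirDeriv u p v =
      sSup ((fun t : ℝ => (u (p + t • v) - u p) / t - C * t) '' Ioi 0) := fun v hv =>
    (hsc.hasPosDirDeriv_sSup hC.le hLip p hv).limUnder_eq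
  have hv : ‖r⁻¹ • (q - p)‖ = 1 := by
    rw [norm_smul, norm_inv, Real.norm_of_nonneg hr.le, ← hr_def, inv_mul_cancel₀ hr.ne']
  have hq : p + r • r⁻¹ • (q - p) = q := by
    rw [smul_inv_smul₀ hr.ne', add_sub_cancel]
  have hle : (u q - u p) / r - C * r ≤ posDirDeriv u p (r⁻¹ • (q - p)) := by
    rw [hderiv _ hv]
    exact le_csSup ⟨K, forall_mem_image.2 fun t ht => hK _ hv t ht⟩ ⟨r, hr, by simp only [hq]⟩
  have hgrad : posDirDeriv u p (r⁻¹ • (q - p)) ≤ gradNorm u p := by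
    refine le_max_of_le_right (le_csSup ⟨K, ?_⟩ ⟨_, hv, rfl⟩)
    rintro _ ⟨w, hw, rfl⟩
    rw [hderiv w hw]
    exact csSup_le (nonempty_Ioi.image _) (forall_mem_image.2 fun t ht => hK w hw t ht)
  have hquot : (u q - u p) / r ≤ gradNorm u p + C * r := by linarith
  rw [div_le_iff₀ hr] at hquot
  linarith
end
end

section
/- Let C > 0 and L > 0. Let (u_k) be a sequence of L-Lipschitz, C-semiconcave functions from ℝⁿ to ℝ converging locally uniformly to a function u_∞ : ℝⁿ → ℝ (which is then L-Lipschitz and C-semiconcave). Then for every convergent sequence of points p_k → p_∞ in ℝⁿ one has |∇u_∞|(p_∞) ≤ liminf_{k→∞} |∇u_k|(p_k). -/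
open Filter Metric Set

noncomputable section

lemma tendsto_const_mul_nhdsGT_zero (C : ℝ) :
    Tendsto (fun t : ℝ => C * t) (nhdsWithin 0 (Ioi 0)) (nhds 0) := by
  have h : Tendsto (fun t : ℝ => C * t) (nhds 0) (nhds (C * 0)) := tendsto_id.const_mul C
  rw [mul_zero] at h
  exact h.mono_left nhdsWithin_le_nhds

/-- The difference quotients of a `C`-semiconcave function along a unit vector, corrected by
`-C t`, decrease in `t`. -/
lemma SemiconcaveOn.antitoneOn_slope {n : ℕ} {C : ℝ} {u : Euc n → ℝ}
    (hu : SemiconcaveOn C Set.univ u) (p : Euc n) {v : Euc n} (hv : ‖v‖ = 1) :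
    AntitoneOn (fun t : ℝ => (u (p + t • v) - u p) / t - C * t) (Ioi 0) := by
  intro s hs t ht hst
  rw [mem_Ioi] at hs ht
  have h := hu p (mem_univ _) (p + t • v) (mem_univ _) (s / t) (by positivity)
    ((div_le_one ht).2 hst)
  have hpt : (1 - s / t) • p + (s / t) • (p + t • v) = p + s • v := by
    rw [smul_add, smul_smul, div_mul_cancel₀ _ ht.ne', sub_smul, one_smul]
    abel
  have hnorm : ‖p - (p + t • v)‖ = t := by
    rw [sub_add_cancel_left, norm_neg, norm_smul, hv, mul_one, Real.norm_of_nonneg ht.le]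
  rw [hpt, hnorm] at h
  have hmul : s * ((u (p + t • v) - u p) / t - C * t) ≤
      s * ((u (p + s • v) - u p) / s - C * s) := by
    have h₁ : s * ((u (p + s • v) - u p) / s - C * s) = u (p + s • v) - u p - C * s * s := by
      field_simp
    have h₂ : C * (s / t) * (1 - s / t) * t ^ 2 = C * s * t - C * s * s := by
      field_simp
    have h₃ : s * ((u (p + t • v) - u p) / t - C * t) =
        s / t * u (p + t • v) - s / t * u p - C * s * t := by
      ring
    rw [h₁, h₃]
    rw [h₂] at h
    linarith
  exact le_of_mul_le_mul_left hmul hs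

/-- Difference quotients of a Lipschitz function along a unit vector are bounded by the Lipschitz
constant. -/
lemma LipschitzWith.slope_le {n : ℕ} {K : NNReal} {u : Euc n → ℝ} (hu : LipschitzWith K u)
    (p : Euc n) {v : Euc n} (hv : ‖v‖ = 1) {t : ℝ} (ht : 0 < t) :
    (u (p + t • v) - u p) / t ≤ K := by
  rw [div_le_iff₀ ht]
  have h := hu.dist_le_mul (p + t • v) p
  rw [Real.dist_eq, dist_eq_norm, add_sub_cancel_left, norm_smul, hv, mul_one,
    Real.norm_of_nonneg ht.le] at h
  exact (le_abs_self _).trans h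

/-- The one-sided directional derivative of a Lipschitz semiconcave function exists. -/
lemma SemiconcaveOn.hasPosDirDeriv {n : ℕ} {C : ℝ} (hC : 0 ≤ C) {K : NNReal} {u : Euc n → ℝ}
    (hu : SemiconcaveOn C Set.univ u) (hK : LipschitzWith K u) (p : Euc n) {v : Euc n}
    (hv : ‖v‖ = 1) : HasPosDirDeriv u p v (posDirDeriv u p v) := by
  have hbdd : BddAbove ((fun t : ℝ => (u (p + t • v) - u p) / t - C * t) '' Ioi 0) := by
    refine ⟨K, ?_⟩
    rintro _ ⟨t, ht, rfl⟩
    rw [mem_Ioi] at ht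
    exact (sub_le_self _ (by positivity)).trans (hK.slope_le p hv ht)
  have h := (hu.antitoneOn_slope p hv).tendsto_nhdsGT hbdd
  refine tendsto_nhds_limUnder ⟨_, (h.add (tendsto_const_mul_nhdsGT_zero C)).congr fun t => ?_⟩
  ring

lemma SemiconcaveOn.slope_sub_le_posDirDeriv {n : ℕ} {C : ℝ} (hC : 0 ≤ C) {K : NNReal}
    {u : Euc n → ℝ} (hu : SemiconcaveOn C Set.univ u) (hK : LipschitzWith K u) (p : Euc n)
    {v : Euc n} (hv : ‖v‖ = 1) {t : ℝ} (ht : 0 < t) :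
    (u (p + t • v) - u p) / t - C * t ≤ posDirDeriv u p v := by
  refine ge_of_tendsto (hu.hasPosDirDeriv hC hK p hv) ?_
  filter_upwards [Ioc_mem_nhdsGT ht] with s hs
  have h := hu.antitoneOn_slope p hv (mem_Ioi.2 hs.1) (mem_Ioi.2 ht) hs.2
  have : 0 ≤ C * s := mul_nonneg hC hs.1.le
  simp only at h
  linarith

lemma SemiconcaveOn.posDirDeriv_le {n : ℕ} {C : ℝ} (hC : 0 ≤ C) {K : NNReal}
    {u : Euc n → ℝ} (hu : SemiconcaveOn C Set.univ u) (hK : LipschitzWith K u) (p : Euc n)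
    {v : Euc n} (hv : ‖v‖ = 1) : posDirDeriv u p v ≤ K := by
  refine le_of_tendsto (hu.hasPosDirDeriv hC hK p hv) ?_
  filter_upwards [self_mem_nhdsWithin] with t ht
  exact hK.slope_le p hv ht

lemma gradNorm_le_of_forall {n : ℕ} {u : Euc n → ℝ} {p : Euc n} {M : ℝ} (hM : 0 ≤ M)
    (h : ∀ v : Euc n, ‖v‖ = 1 → posDirDeriv u p v ≤ M) : gradNorm u p ≤ M := by
  refine max_le hM (Real.sSup_le ?_ hM)
  rintro _ ⟨v, hv, rfl⟩
  exact h v hv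

lemma SemiconcaveOn.posDirDeriv_le_gradNorm {n : ℕ} {C : ℝ} (hC : 0 ≤ C) {K : NNReal}
    {u : Euc n → ℝ} (hu : SemiconcaveOn C Set.univ u) (hK : LipschitzWith K u) (p : Euc n)
    {v : Euc n} (hv : ‖v‖ = 1) : posDirDeriv u p v ≤ gradNorm u p := by
  refine le_max_of_le_right (le_csSup ⟨K, ?_⟩ ⟨v, hv, rfl⟩)
  rintro _ ⟨w, hw, rfl⟩
  exact hu.posDirDeriv_le hC hK p hw

/-- Semiconcavity passes to pointwise limits. -/
lemma SemiconcaveOn.of_tendsto {n : ℕ} {C : ℝ} {S : Set (Euc n)} (hS : Convex ℝ S)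
    {u : ℕ → Euc n → ℝ} {w : Euc n → ℝ} (hu : ∀ k, SemiconcaveOn C S (u k))
    (h : ∀ x ∈ S, Tendsto (fun k => u k x) atTop (nhds (w x))) : SemiconcaveOn C S w := by
  intro x hx y hy l hl₀ hl₁
  have hz : (1 - l) • x + l • y ∈ S := hS hx hy (by linarith) hl₀ (by ring)
  exact le_of_tendsto' ((((h x hx).const_mul (1 - l)).add ((h y hy).const_mul l)).sub (h _ hz))
    fun k => hu k x hx y hy l hl₀ hl₁

theorem stmt5 {n : ℕ} (hn : 0 < n) (C L : ℝ) (hC : 0 < C) (hL : 0 < L)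
    (u : ℕ → Euc n → ℝ) (hLip : ∀ k, LipschitzWith (Real.toNNReal L) (u k))
    (hsc : ∀ k, SemiconcaveOn C Set.univ (u k))
    (uinf : Euc n → ℝ)
    (hconv : TendstoLocallyUniformly (fun k => u k) uinf atTop)
    (p : ℕ → Euc n) (pinf : Euc n) (hp : Tendsto p atTop (nhds pinf)) :
    gradNorm uinf pinf ≤ Filter.liminf (fun k => gradNorm (u k) (p k)) atTop := by
  have hC₀ := hC.le
  have hcont : Continuous uinf :=
    hconv.continuous (Frequently.of_forall fun k => (hLip k).continuous)
  have hpt : ∀ x, Tendsto (fun k => u k x) atTop (nhds (uinf x)) := fun x =>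
    hconv.tendsto_comp hcont.continuousAt tendsto_const_nhds
  have hLipinf : LipschitzWith (Real.toNNReal L) uinf := by
    refine LipschitzWith.of_dist_le_mul fun x y => ?_
    exact le_of_tendsto' ((hpt x).dist (hpt y)) fun k => (hLip k).dist_le_mul x y
  have hscinf : SemiconcaveOn C Set.univ uinf :=
    SemiconcaveOn.of_tendsto convex_univ hsc fun x _ => hpt x
  have hcobdd : IsCoboundedUnder (· ≥ ·) atTop fun k => gradNorm (u k) (p k) :=
    (isBoundedUnder_of ⟨Real.toNNReal L, fun k =>
      gradNorm_le_of_forall (NNReal.coe_nonneg _) fun v hv =>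
        (hsc k).posDirDeriv_le hC₀ (hLip k) (p k) hv⟩ :
      IsBoundedUnder (· ≤ ·) atTop fun k => gradNorm (u k) (p k)).isCoboundedUnder_ge
  refine gradNorm_le_of_forall
    (le_liminf_of_le hcobdd (Eventually.of_forall fun k => le_max_left _ _)) fun v hv => ?_
  have hslope : ∀ t : ℝ, 0 < t → (uinf (pinf + t • v) - uinf pinf) / t - C * t ≤
      liminf (fun k => gradNorm (u k) (p k)) atTop := by
    intro t ht
    have hlim : Tendsto (fun k => (u k (p k + t • v) - u k (p k)) / t - C * t) atTop
        (nhds ((uinf (pinf + t • v) - uinf pinf) / t - C * t)) :=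
      (((hconv.tendsto_comp hcont.continuousAt (hp.add_const (t • v))).sub
        (hconv.tendsto_comp hcont.continuousAt hp)).div_const t).sub_const (C * t)
    rw [← hlim.liminf_eq]
    exact liminf_le_liminf (Eventually.of_forall fun k =>
      ((hsc k).slope_sub_le_posDirDeriv hC₀ (hLip k) (p k) hv ht).trans
        ((hsc k).posDirDeriv_le_gradNorm hC₀ (hLip k) (p k) hv))
      hlim.isBoundedUnder_ge hcobdd
  have hderiv := (hscinf.hasPosDirDeriv hC₀ hLipinf pinf hv).sub
    (tendsto_const_mul_nhdsGT_zero C)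
  rw [sub_zero] at hderiv
  refine le_of_tendsto hderiv ?_
  filter_upwards [self_mem_nhdsWithin] with t ht
  exact hslope t ht
end
end

section
/- Let K ⊆ ℝⁿ be a nonempty compact set and let p ∈ ℝⁿ \ K be a point having at least two distinct nearest points on K. Then |∇d_K|(p) < 1. -/
open Filter Metric Set

noncomputable section

theorem HasPosDirDeriv.posDirDeriv_eq {n : ℕ} {u : Euc n → ℝ} {p v : Euc n} {d : ℝ}
    (h : HasPosDirDeriv u p v d) : posDirDeriv u p v = d :=
  Tendsto.limUnder_eq h

theorem norm_add_smul_sub_sq {n : ℕ} (p v y : Euc n) (t : ℝ) :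
    ‖p + t • v - y‖ ^ 2 = ‖p - y‖ ^ 2 + 2 * t * inner ℝ (p - y) v + t ^ 2 * ‖v‖ ^ 2 := by
  rw [show p + t • v - y = (p - y) + t • v by abel, norm_add_sq_real, inner_smul_right, norm_smul,
    mul_pow, Real.norm_eq_abs, sq_abs]
  ring

theorem affine_le_sq_sub_infDist_sq {n : ℕ} {K : Set (Euc n)} {y : Euc n} (hy : y ∈ K)
    (p v : Euc n) (t : ℝ) :
    -‖p - y‖ ^ 2 - 2 * t * inner ℝ (p - y) v ≤
      t ^ 2 * ‖v‖ ^ 2 - Metric.infDist (p + t • v) K ^ 2 := by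
  have h := pow_le_pow_left₀ Metric.infDist_nonneg
    (Metric.infDist_le_dist_of_mem (x := p + t • v) hy) 2
  rw [dist_eq_norm, norm_add_smul_sub_sq] at h
  linarith

theorem convexOn_sq_sub_infDist_sq {n : ℕ} {K : Set (Euc n)} (hK : IsCompact K)
    (hne : K.Nonempty) (p v : Euc n) :
    ConvexOn ℝ univ (fun t : ℝ => t ^ 2 * ‖v‖ ^ 2 - Metric.infDist (p + t • v) K ^ 2) := by
  refine ⟨convex_univ, fun s _ t _ a b ha hb hab => ?_⟩
  obtain ⟨y, hy, hdist⟩ := hK.exists_infDist_eq_dist hne (p + (a • s + b • t) • v)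
  have hs := mul_le_mul_of_nonneg_left (affine_le_sq_sub_infDist_sq hy p v s) ha
  have ht := mul_le_mul_of_nonneg_left (affine_le_sq_sub_infDist_sq hy p v t) hb
  simp only [hdist, dist_eq_norm, norm_add_smul_sub_sq]
  simp only [smul_eq_mul] at *
  obtain rfl : b = 1 - a := by linarith
  linarith

/-- Away from `K`, the distance to `K` has one-sided directional derivatives, bounded by those of
the distance to any nearest point. -/
theorem exists_hasPosDirDeriv_infDist {n : ℕ} {K : Set (Euc n)} (hK : IsCompact K)
    (hne : K.Nonempty) (p v : Euc n) (hp : 0 < Metric.infDist p K) :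
    ∃ d, HasPosDirDeriv (fun x => Metric.infDist x K) p v d ∧
      ∀ y ∈ K, dist p y = Metric.infDist p K →
        d * Metric.infDist p K ≤ inner ℝ (p - y) v := by
  set g : ℝ → ℝ := fun t => t ^ 2 * ‖v‖ ^ 2 - Metric.infDist (p + t • v) K ^ 2 with hg
  obtain ⟨m, hm⟩ : ∃ m, HasDerivWithinAt g m (Ioi 0) 0 :=
    ⟨_, (convexOn_sq_sub_infDist_sq hK hne p v).hasDerivWithinAt_rightDeriv_of_mem_interior
      (by simp)⟩
  have hsq : HasDerivWithinAt (fun t : ℝ => t ^ 2 * ‖v‖ ^ 2) 0 (Ioi 0) 0 := by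
    simpa using ((hasDerivAt_pow 2 (0 : ℝ)).mul_const (‖v‖ ^ 2)).hasDerivWithinAt (s := Ioi 0)
  have hd : HasDerivWithinAt (fun t : ℝ => Metric.infDist (p + t • v) K)
      (-m / (2 * Metric.infDist p K)) (Ioi 0) 0 := by
    have h := (hsq.sub hm).sqrt (by simp [hg, hp.ne'])
    simpa [hg, Real.sqrt_sq Metric.infDist_nonneg] using h
  refine ⟨-m / (2 * Metric.infDist p K), ?_, fun y hy hpy => ?_⟩
  · rw [hasDerivWithinAt_iff_tendsto_slope' self_notMem_Ioi] at hd
    refine hd.congr fun t => ?_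
    simp [slope_def_field]
  · have hlow : -(2 * inner ℝ (p - y) v) ≤ m := by
      rw [hasDerivWithinAt_iff_tendsto_slope' self_notMem_Ioi] at hm
      refine ge_of_tendsto hm (eventually_mem_nhdsWithin.mono fun t ht => ?_)
      have ht' : (0 : ℝ) < t := ht
      have h := affine_le_sq_sub_infDist_sq hy p v t
      rw [← dist_eq_norm, hpy] at h
      rw [slope_def_field, sub_zero, le_div_iff₀ ht']
      simp only [hg, zero_smul, add_zero]
      linarith
    have : -m / (2 * Metric.infDist p K) * Metric.infDist p K = -m / 2 := by
      field_simp
    linarith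

theorem stmt9 {n : ℕ} (K : Set (Euc n)) (hne : K.Nonempty) (hK : IsCompact K)
    (p : Euc n) (hp : p ∉ K) (y₁ y₂ : Euc n) (hy₁ : y₁ ∈ K) (hy₂ : y₂ ∈ K)
    (hd₁ : dist p y₁ = Metric.infDist p K) (hd₂ : dist p y₂ = Metric.infDist p K)
    (hne12 : y₁ ≠ y₂) :
    gradNorm (fun x => Metric.infDist x K) p < 1 := by
  set r := Metric.infDist p K with hr
  have hr0 : 0 < r := (hK.isClosed.notMem_iff_infDist_pos hne).1 hp
  set w := (p - y₁) + (p - y₂) with hw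
  have hpar := parallelogram_law_with_norm ℝ (p - y₁) (p - y₂)
  have hdiff : 0 < ‖(p - y₁) - (p - y₂)‖ := by
    rw [norm_pos_iff, sub_sub_sub_cancel_left, sub_ne_zero]
    exact hne12.symm
  rw [← dist_eq_norm p y₁, ← dist_eq_norm p y₂, hd₁, hd₂, ← hw] at hpar
  have hwr : ‖w‖ < 2 * r := by
    refine lt_of_pow_lt_pow_left₀ 2 (by positivity) ?_
    nlinarith [pow_pos hdiff 2]
  have hwr' : ‖w‖ / (2 * r) < 1 := (div_lt_one (by positivity)).2 hwr
  refine max_lt one_pos (lt_of_le_of_lt (Real.sSup_le ?_ (by positivity)) hwr')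
  rintro d ⟨v, hv, rfl⟩
  obtain ⟨d, hd, hle⟩ := exists_hasPosDirDeriv_infDist hK hne p v hr0
  rw [hd.posDirDeriv_eq, le_div_iff₀ (by positivity)]
  have h₁ := hle y₁ hy₁ hd₁
  have h₂ := hle y₂ hy₂ hd₂
  have h₃ := real_inner_le_norm w v
  rw [hv, mul_one, hw, inner_add_left] at h₃
  rw [← hr] at h₁ h₂
  linarith
end
end

section
/- Let K ⊆ ℝⁿ be a nonempty compact set. Then the function x ↦ ‖x‖² − d_K(x)² is convex on ℝⁿ. -/
open Filter Metric Set

noncomputable section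

/-- `‖x‖² - ‖x - p‖²` is an affine function of `x` and bounds `‖x‖² - d_K(x)²` from below for
every `p ∈ K`. -/
theorem two_inner_sub_norm_sq_le {n : ℕ} {K : Set (Euc n)} {p : Euc n} (hp : p ∈ K) (x : Euc n) :
    2 * inner ℝ x p - ‖p‖ ^ 2 ≤ ‖x‖ ^ 2 - Metric.infDist x K ^ 2 := by
  have hdist : Metric.infDist x K ≤ ‖x - p‖ := by
    simpa [dist_eq_norm] using Metric.infDist_le_dist_of_mem (x := x) hp
  have hsq := pow_le_pow_left₀ Metric.infDist_nonneg hdist 2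
  rw [norm_sub_sq_real] at hsq
  linarith

theorem stmt10 {n : ℕ} (K : Set (Euc n)) (hne : K.Nonempty) (hK : IsCompact K) :
    ConvexOn ℝ Set.univ (fun x : Euc n => ‖x‖ ^ 2 - Metric.infDist x K ^ 2) := by
  refine ⟨convex_univ, fun x _ y _ a b ha hb hab => ?_⟩
  obtain ⟨p, hp, hdist⟩ := hK.exists_infDist_eq_dist hne (a • x + b • y)
  have hx := mul_le_mul_of_nonneg_left (two_inner_sub_norm_sq_le hp x) ha
  have hy := mul_le_mul_of_nonneg_left (two_inner_sub_norm_sq_le hp y) hb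
  simp only [smul_eq_mul]
  rw [hdist, dist_eq_norm, norm_sub_sq_real, inner_add_left, real_inner_smul_left,
    real_inner_smul_left]
  linear_combination hx + hy + ‖p‖ ^ 2 * hab
end
end

section
/- Let K ⊆ ℝⁿ be a nonempty compact set and ρ > 0. Then for all x, y ∈ ℝⁿ and all λ ∈ [0,1] such that d_K((1−λ)x + λy) ≥ ρ, one has (1−λ)·d_K(x) + λ·d_K(y) − d_K((1−λ)x + λy) ≤ (1/ρ)·λ·(1−λ)·‖x − y‖². In particular, d_K is (1/ρ)-semiconcave on every convex subset of {x ∈ ℝⁿ : d_K(x) ≥ ρ}. -/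
open Filter Metric Set

noncomputable section

/-- Stewart's identity in an inner product space. -/
theorem norm_sq_convexComb_sub {E : Type*} [NormedAddCommGroup E] [InnerProductSpace ℝ E]
    (x y p : E) (l : ℝ) :
    (1 - l) * ‖x - p‖ ^ 2 + l * ‖y - p‖ ^ 2 =
      ‖(1 - l) • x + l • y - p‖ ^ 2 + l * (1 - l) * ‖x - y‖ ^ 2 := by
  have h1 : (1 - l) • x + l • y - p = (1 - l) • (x - p) + l • (y - p) := by module
  have h2 : x - y = (x - p) - (y - p) := by abel
  rw [h1, h2, norm_add_sq_real, norm_sub_sq_real (x - p) (y - p), norm_smul, norm_smul,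
    inner_smul_left, inner_smul_right, mul_pow, mul_pow, Real.norm_eq_abs,
    Real.norm_eq_abs, sq_abs, sq_abs]
  simp only [conj_trivial]
  ring

/-- The distance to a point is semiconcave, with a constant controlled by the distance from the
intermediate point. -/
theorem norm_convexComb_sub_le {E : Type*} [NormedAddCommGroup E] [InnerProductSpace ℝ E]
    (x y p : E) {l ρ : ℝ} (hl0 : 0 ≤ l) (hl1 : l ≤ 1) (hρ : 0 < ρ)
    (h : ρ ≤ ‖(1 - l) • x + l • y - p‖) :
    (1 - l) * ‖x - p‖ + l * ‖y - p‖ - ‖(1 - l) • x + l • y - p‖ ≤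
      (1 / ρ) * l * (1 - l) * ‖x - y‖ ^ 2 := by
  have key := norm_sq_convexComb_sub x y p l
  set r := ‖(1 - l) • x + l • y - p‖
  set a := ‖x - p‖
  set b := ‖y - p‖
  have hl : 0 ≤ 1 - l := sub_nonneg.2 hl1
  have hr : 0 < r := hρ.trans_le h
  set D := l * (1 - l) * ‖x - y‖ ^ 2 with hD
  have hD0 : 0 ≤ D := by positivity
  have h1 : (1 - l) * a + l * b - r ≤ D / r := by
    rw [le_div_iff₀ hr]
    nlinarith [mul_nonneg hl (sq_nonneg (a - r)), mul_nonneg hl0 (sq_nonneg (b - r))]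
  calc (1 - l) * a + l * b - r ≤ D / r := h1
    _ ≤ D / ρ := div_le_div_of_nonneg_left hD0 hρ h
    _ = (1 / ρ) * l * (1 - l) * ‖x - y‖ ^ 2 := by rw [hD]; ring

theorem stmt11 {n : ℕ} (K : Set (Euc n)) (hne : K.Nonempty) (hK : IsCompact K)
    (ρ : ℝ) (hρ : 0 < ρ) :
    (∀ x y : Euc n, ∀ l : ℝ, 0 ≤ l → l ≤ 1 →
      ρ ≤ Metric.infDist ((1 - l) • x + l • y) K →
      (1 - l) * Metric.infDist x K + l * Metric.infDist y K -
        Metric.infDist ((1 - l) • x + l • y) K ≤ (1 / ρ) * l * (1 - l) * ‖x - y‖ ^ 2) ∧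
    (∀ S : Set (Euc n), Convex ℝ S → S ⊆ {x : Euc n | ρ ≤ Metric.infDist x K} →
      SemiconcaveOn (1 / ρ) S (fun x => Metric.infDist x K)) := by
  have main : ∀ x y : Euc n, ∀ l : ℝ, 0 ≤ l → l ≤ 1 →
      ρ ≤ Metric.infDist ((1 - l) • x + l • y) K →
      (1 - l) * Metric.infDist x K + l * Metric.infDist y K -
        Metric.infDist ((1 - l) • x + l • y) K ≤ (1 / ρ) * l * (1 - l) * ‖x - y‖ ^ 2 := by
    intro x y l hl0 hl1 h
    obtain ⟨p, hp, hpd⟩ := hK.exists_infDist_eq_dist hne ((1 - l) • x + l • y)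
    rw [hpd, dist_eq_norm] at h ⊢
    have hx : Metric.infDist x K ≤ ‖x - p‖ := dist_eq_norm x p ▸ infDist_le_dist_of_mem hp
    have hy : Metric.infDist y K ≤ ‖y - p‖ := dist_eq_norm y p ▸ infDist_le_dist_of_mem hp
    have hl : 0 ≤ 1 - l := sub_nonneg.2 hl1
    linarith [norm_convexComb_sub_le x y p hl0 hl1 hρ h, mul_le_mul_of_nonneg_left hx hl,
      mul_le_mul_of_nonneg_left hy hl0]
  exact ⟨main, fun S hS hSK x hx y hy l hl0 hl1 => main x y l hl0 hl1
    (hSK (hS hx hy (sub_nonneg.2 hl1) hl0 (sub_add_cancel 1 l)))⟩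
end
end

section
/- Let a < b, α ≥ 0, and let γ : [a,b] → ℝⁿ be a twice continuously differentiable curve with ‖γ''(t)‖ ≤ α for all t ∈ [a,b]. Then for every λ ∈ [0,1], ‖γ((1−λ)a + λb) − ((1−λ)·γ(a) + λ·γ(b))‖ ≤ 2α·λ·(1−λ)·(b−a)². -/
open Filter Metric Set

noncomputable section

/-- First-order Taylor estimate on an interval for a curve whose second derivative is bounded. -/
theorem norm_image_sub_sub_smul_deriv_le {E : Type*} [NormedAddCommGroup E] [NormedSpace ℝ E]
    {s : Set ℝ} (hs : Convex ℝ s) {f f' f'' : ℝ → E} {α : ℝ}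
    (hf : ∀ t ∈ s, HasDerivWithinAt f (f' t) s t)
    (hf' : ∀ t ∈ s, HasDerivWithinAt f' (f'' t) s t)
    (hbound : ∀ t ∈ s, ‖f'' t‖ ≤ α) {c x : ℝ} (hc : c ∈ s) (hx : x ∈ s) :
    ‖f x - f c - (x - c) • f' c‖ ≤ α * (x - c) ^ 2 := by
  have hα : 0 ≤ α := (norm_nonneg _).trans (hbound c hc)
  have hsub : Set.uIcc c x ⊆ s := hs.ordConnected.uIcc_subset hc hx
  have hder : ∀ t ∈ Set.uIcc c x, HasDerivWithinAt (fun t => f t - t • f' c)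
      (f' t - f' c) (Set.uIcc c x) t := fun t ht => by
    simpa using ((hf t (hsub ht)).mono hsub).fun_sub
      ((hasDerivWithinAt_id t (Set.uIcc c x)).smul_const (f' c))
  have hle : ∀ t ∈ Set.uIcc c x, ‖f' t - f' c‖ ≤ α * |x - c| := fun t ht =>
    (hs.norm_image_sub_le_of_norm_hasDerivWithin_le hf' hbound hc (hsub ht)).trans
      (mul_le_mul_of_nonneg_left (Set.abs_sub_left_of_mem_uIcc ht) hα)
  have key := (convex_uIcc c x).norm_image_sub_le_of_norm_hasDerivWithin_le hder hle
    Set.left_mem_uIcc Set.right_mem_uIcc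
  calc ‖f x - f c - (x - c) • f' c‖ = ‖f x - x • f' c - (f c - c • f' c)‖ := by
        congr 1; module
    _ ≤ α * |x - c| * |x - c| := key
    _ = α * (x - c) ^ 2 := by rw [mul_assoc, abs_mul_abs_self, sq]

theorem stmt12 {n : ℕ} (a b : ℝ) (hab : a < b) (α : ℝ) (hα : 0 ≤ α)
    (γ γ' γ'' : ℝ → Euc n)
    (hderiv1 : ∀ t ∈ Set.Icc a b, HasDerivWithinAt γ (γ' t) (Set.Icc a b) t)
    (hderiv2 : ∀ t ∈ Set.Icc a b, HasDerivWithinAt γ' (γ'' t) (Set.Icc a b) t)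
    (hcont : ContinuousOn γ'' (Set.Icc a b))
    (hbound : ∀ t ∈ Set.Icc a b, ‖γ'' t‖ ≤ α) :
    ∀ l : ℝ, 0 ≤ l → l ≤ 1 →
      ‖γ ((1 - l) * a + l * b) - ((1 - l) • γ a + l • γ b)‖ ≤
        2 * α * l * (1 - l) * (b - a) ^ 2 := by
  intro l hl0 hl1
  set c := (1 - l) * a + l * b with hc
  have ha : a ∈ Set.Icc a b := Set.left_mem_Icc.2 hab.le
  have hb : b ∈ Set.Icc a b := Set.right_mem_Icc.2 hab.le
  have hl1' : 0 ≤ 1 - l := sub_nonneg.2 hl1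
  have hcm : c ∈ Set.Icc a b := convex_Icc a b ha hb hl1' hl0 (by ring)
  have hA := norm_image_sub_sub_smul_deriv_le (convex_Icc a b) hderiv1 hderiv2 hbound hcm ha
  have hB := norm_image_sub_sub_smul_deriv_le (convex_Icc a b) hderiv1 hderiv2 hbound hcm hb
  have hac : a - c = -(l * (b - a)) := by rw [hc]; ring
  have hbc : b - c = (1 - l) * (b - a) := by rw [hc]; ring
  rw [hac] at hA
  rw [hbc] at hB
  have hnonneg : 0 ≤ α * l * (1 - l) * (b - a) ^ 2 := by positivity
  calc ‖γ c - ((1 - l) • γ a + l • γ b)‖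
      = ‖(1 - l) • (γ a - γ c - (-(l * (b - a))) • γ' c)
          + l • (γ b - γ c - ((1 - l) * (b - a)) • γ' c)‖ := by
        rw [← norm_neg]; congr 1; module
    _ ≤ (1 - l) * (α * (-(l * (b - a))) ^ 2) + l * (α * ((1 - l) * (b - a)) ^ 2) := by
        refine (norm_add_le _ _).trans ?_
        rw [norm_smul, norm_smul, Real.norm_of_nonneg hl1', Real.norm_of_nonneg hl0]
        gcongr
    _ = α * l * (1 - l) * (b - a) ^ 2 := by ring
    _ ≤ 2 * α * l * (1 - l) * (b - a) ^ 2 := by linarith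
end
end
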